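/- Let E_0 ≤ E_1 ≤ E_2 ≤ E_3 be real numbers and let 0 ≤ β' ≤ β. Let p = p(β) and q = p(β') be the corresponding Gibbs vectors in ℝ⁴, and for i ∈ {0,1,2} define r_i ∈ ℝ⁴ by (r_i)_j = p_j·p_{j+i mod 4}. Then there exist 4×4 doubly stochastic matrices M_0, M_1, M_2 such that q = M_0 r_0 + (𝟙+Π) M_1 r_1 + (1/2)(𝟙+Π²) M_2 r_2, where Π is the 4×4 cyclic permutation matrix. (In other words, for two identical 4-dimensional systems initially thermal at inverse temperature β there is a symmetrically thermalizing transformation reaching any hotter thermal marginal.) -/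

import Mathlib

/-- The Gibbs probability vector of energies `E` at inverse temperature `β`. -/
noncomputable def gibbs {d : ℕ} (E : Fin d → ℝ) (β : ℝ) : Fin d → ℝ :=
  fun i => Real.exp (-(β * E i)) / ∑ j, Real.exp (-(β * E j))

/-- A real square matrix is doubly stochastic if it has nonnegative entries and
all rows and columns sum to `1`. -/
def DoublyStochastic {n : ℕ} (M : Matrix (Fin n) (Fin n) ℝ) : Prop :=
  (∀ i j, 0 ≤ M i j) ∧ (∀ i, ∑ j, M i j = 1) ∧ (∀ j, ∑ i, M i j = 1)

/-- The cyclic permutation matrix `Π` with `Π i j = 1` iff `i ≡ j + 1 (mod n)`. -/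
def cyc (n : ℕ) : Matrix (Fin n) (Fin n) ℝ :=
  Matrix.of fun i j => if (i : ℕ) = ((j : ℕ) + 1) % n then 1 else 0

/-- Support-function value of the vertex of the reachable polytope given by three permutations. -/
noncomputable def vval (a b c y : Fin 4 → ℝ) (s0 s1 s2 : Equiv.Perm (Fin 4)) : ℝ :=
  ∑ i, y i * a (s0 i) + ∑ i, (y i + y (i + 1)) * b (s1 i)
    + (1 / 2) * ∑ i, (y i + y (i + 2)) * c (s2 i)

/-- The facet inequalities of the reachable polytope. -/
structure Facets (a b c q : Fin 4 → ℝ) : Prop where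
  total : ∑ i, q i = ∑ i, a i + 2 * ∑ i, b i + ∑ i, c i
  sing : ∀ i, q i ≤ a 0 + b 0 + b 1 + (c 0 + c 1) / 2
  trip : ∀ i, a 3 + b 2 + b 3 + (c 2 + c 3) / 2 ≤ q i
  adj : ∀ i j : Fin 4, (j = i + 1 ∨ i = j + 1) →
    q i + q j ≤ a 0 + a 1 + 2 * b 0 + b 1 + b 2 + (c 0 + c 1 + c 2 + c 3) / 2
  opp : ∀ i j : Fin 4, j = i + 2 →
    q i + q j ≤ a 0 + a 1 + b 0 + b 1 + b 2 + b 3 + c 0 + c 1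
  dadj : ∀ i j : Fin 4, (j = i + 1 ∨ i = j + 1) →
    q i - q j ≤ a 0 - a 3 + b 0 - b 3 + (c 0 + c 1 - c 2 - c 3) / 2
  dopp : ∀ i j : Fin 4, j = i + 2 →
    q i - q j ≤ a 0 - a 3 + b 0 + b 1 - b 2 - b 3

lemma Facets.rot {a b c q : Fin 4 → ℝ} (h : Facets a b c q) :
    Facets a b c (fun i => q (i + 1)) where
  total := by
    rw [← h.total]; exact Equiv.sum_comp (Equiv.addRight (1 : Fin 4)) q
  sing := fun i => h.sing _
  trip := fun i => h.trip _
  adj := fun i j hij => h.adj _ _ (by revert i j; decide)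
  opp := fun i j hij => h.opp _ _ (by revert i j; decide)
  dadj := fun i j hij => h.dadj _ _ (by revert i j; decide)
  dopp := fun i j hij => h.dopp _ _ (by revert i j; decide)

lemma Facets.refl {a b c q : Fin 4 → ℝ} (h : Facets a b c q) :
    Facets a b c (fun i => q (-i)) where
  total := by
    rw [← h.total]; exact Equiv.sum_comp (Equiv.neg (Fin 4)) q
  sing := fun i => h.sing _
  trip := fun i => h.trip _
  adj := fun i j hij => h.adj _ _ (by revert i j; decide)
  opp := fun i j hij => h.opp _ _ (by revert i j; decide)
  dadj := fun i j hij => h.dadj _ _ (by revert i j; decide)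
  dopp := fun i j hij => h.dopp _ _ (by revert i j; decide)

/-- The direction `y` does not separate `q` from the vertices. -/
def Good (a b c y q : Fin 4 → ℝ) : Prop :=
  ∃ s0 s1 s2 : Equiv.Perm (Fin 4), ∑ i, y i * q i ≤ vval a b c y s0 s1 s2

lemma Good.of_rot {a b c y q : Fin 4 → ℝ}
    (h : Good a b c (fun i => y (i + 1)) (fun i => q (i + 1))) : Good a b c y q := by
  obtain ⟨s0, s1, s2, h⟩ := h
  refine ⟨(Equiv.subRight 1).trans s0, (Equiv.subRight 1).trans s1,
    (Equiv.subRight 1).trans s2, ?_⟩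
  have e0 : (0 : Fin 4) - 1 = 3 := by decide
  have e1 : (1 : Fin 4) - 1 = 0 := by decide
  have e2 : (2 : Fin 4) - 1 = 1 := by decide
  have e3 : (3 : Fin 4) - 1 = 2 := by decide
  have f1 : (1 : Fin 4) + 1 = 2 := by decide
  have f2 : (2 : Fin 4) + 1 = 3 := by decide
  have f3 : (3 : Fin 4) + 1 = 0 := by decide
  have g1 : (1 : Fin 4) + 2 = 3 := by decide
  have g2 : (2 : Fin 4) + 2 = 0 := by decide
  have g3 : (3 : Fin 4) + 2 = 1 := by decide
  simp only [vval, Fin.sum_univ_four, Equiv.trans_apply, Equiv.subRight_apply, zero_add,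
    e0, e1, e2, e3, f1, f2, f3, g1, g2, g3] at h ⊢
  linarith

lemma Good.of_refl {a b c y q : Fin 4 → ℝ}
    (h : Good a b c (fun i => y (-i)) (fun i => q (-i))) : Good a b c y q := by
  obtain ⟨s0, s1, s2, h⟩ := h
  refine ⟨(Equiv.neg _).trans s0, (Equiv.subLeft 3).trans s1,
    (Equiv.neg _).trans s2, ?_⟩
  have e1 : -(1 : Fin 4) = 3 := by decide
  have e2 : -(2 : Fin 4) = 2 := by decide
  have e3 : -(3 : Fin 4) = 1 := by decide
  have d1 : (3 : Fin 4) - 1 = 2 := by decide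
  have d2 : (3 : Fin 4) - 2 = 1 := by decide
  have d3 : (3 : Fin 4) - 3 = 0 := by decide
  have d0 : (3 : Fin 4) - 0 = 3 := by decide
  have d4 : -(0 : Fin 4) = 0 := by decide
  have f1 : (1 : Fin 4) + 1 = 2 := by decide
  have f2 : (2 : Fin 4) + 1 = 3 := by decide
  have f3 : (3 : Fin 4) + 1 = 0 := by decide
  have g1 : (1 : Fin 4) + 2 = 3 := by decide
  have g2 : (2 : Fin 4) + 2 = 0 := by decide
  have g3 : (3 : Fin 4) + 2 = 1 := by decide
  simp only [vval, Fin.sum_univ_four, Equiv.trans_apply, Equiv.subLeft_apply, Equiv.neg_apply,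
    zero_add, e1, e2, e3, d0, d1, d2, d3, d4, f1, f2, f3, g1, g2, g3] at h ⊢
  linarith

/-- Build a permutation of `Fin 4` with prescribed values. -/
lemma exists_perm (f : Fin 4 → Fin 4) (hf : Function.Injective f) :
    ∃ s : Equiv.Perm (Fin 4), s 0 = f 0 ∧ s 1 = f 1 ∧ s 2 = f 2 ∧ s 3 = f 3 :=
  ⟨Equiv.ofBijective f (Finite.injective_iff_bijective.mp hf), rfl, rfl, rfl, rfl⟩

lemma good_of_perm {a b c y q : Fin 4 → ℝ} (f0 f1 f2 : Fin 4 → Fin 4)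
    (h0 : Function.Injective f0) (h1 : Function.Injective f1) (h2 : Function.Injective f2)
    (h : y 0 * q 0 + y 1 * q 1 + y 2 * q 2 + y 3 * q 3 ≤
      (y 0 * a (f0 0) + y 1 * a (f0 1) + y 2 * a (f0 2) + y 3 * a (f0 3)) +
      ((y 0 + y 1) * b (f1 0) + (y 1 + y 2) * b (f1 1) + (y 2 + y 3) * b (f1 2)
        + (y 3 + y 0) * b (f1 3)) +
      (1 / 2) * ((y 0 + y 2) * c (f2 0) + (y 1 + y 3) * c (f2 1) + (y 2 + y 0) * c (f2 2)
        + (y 3 + y 1) * c (f2 3))) : Good a b c y q := by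
  refine ⟨Equiv.ofBijective f0 (Finite.injective_iff_bijective.mp h0),
    Equiv.ofBijective f1 (Finite.injective_iff_bijective.mp h1),
    Equiv.ofBijective f2 (Finite.injective_iff_bijective.mp h2), ?_⟩
  have e1 : (1 : Fin 4) + 1 = 2 := by decide
  have e2 : (2 : Fin 4) + 1 = 3 := by decide
  have e3 : (3 : Fin 4) + 1 = 0 := by decide
  have g1 : (1 : Fin 4) + 2 = 3 := by decide
  have g2 : (2 : Fin 4) + 2 = 0 := by decide
  have g3 : (3 : Fin 4) + 2 = 1 := by decide
  simp only [vval, Fin.sum_univ_four, Equiv.ofBijective_apply, zero_add,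
    e1, e2, e3, g1, g2, g3]
  exact h

lemma good_fund {a b c y q : Fin 4 → ℝ} (h : Facets a b c q)
    (h1 : y 1 ≤ y 0) (h2 : y 2 ≤ y 0) (h3 : y 3 ≤ y 1) : Good a b c y q := by
  have ht := h.total
  simp only [Fin.sum_univ_four] at ht
  have ht' : y 3 * (q 0 + q 1 + q 2 + q 3) = _ := congrArg (y 3 * ·) ht
  have ht2 : y 2 * (q 0 + q 1 + q 2 + q 3) = _ := congrArg (y 2 * ·) ht
  have ht1 : y 1 * (q 0 + q 1 + q 2 + q 3) = _ := congrArg (y 1 * ·) ht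
  have ht0 : y 0 * (q 0 + q 1 + q 2 + q 3) = _ := congrArg (y 0 * ·) ht
  have hs := h.sing 0
  have htr3 := h.trip 3
  have htr2 := h.trip 2
  have hadj := h.adj 0 1 (by decide)
  have hopp := h.opp 0 2 (by decide)
  have hd3 := h.dadj 0 3 (by decide)
  have hd2 := h.dopp 0 2 (by decide)
  rcases le_total (y 2) (y 3) with h23 | h23
  · rcases le_total (y 0 + y 2) (y 1 + y 3) with hw | hw
    · refine good_of_perm ![0, 1, 3, 2] ![0, 2, 3, 1] ![2, 0, 3, 1]
        (by decide) (by decide) (by decide) ?_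
      have m1 := mul_le_mul_of_nonneg_left hd2 (sub_nonneg.2 h1)
      have m2 := mul_le_mul_of_nonneg_left hadj (sub_nonneg.2 h3)
      have m3 := mul_le_mul_of_nonneg_left htr2 (sub_nonneg.2 hw)
      simp
      linarith
    · refine good_of_perm ![0, 1, 3, 2] ![0, 2, 3, 1] ![0, 2, 1, 3]
        (by decide) (by decide) (by decide) ?_
      have m1 := mul_le_mul_of_nonneg_left hd2 (sub_nonneg.2 h23)
      have m2 := mul_le_mul_of_nonneg_left hadj (sub_nonneg.2 h3)
      have m3 := mul_le_mul_of_nonneg_left hs (sub_nonneg.2 hw)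
      simp
      linarith
  · rcases le_total (y 1) (y 2) with h12 | h12
    · rcases le_total (y 0 + y 3) (y 1 + y 2) with hw | hw
      · refine good_of_perm ![0, 2, 1, 3] ![0, 1, 3, 2] ![0, 2, 1, 3]
          (by decide) (by decide) (by decide) ?_
        have m1 := mul_le_mul_of_nonneg_left hd3 (sub_nonneg.2 h2)
        have m2 := mul_le_mul_of_nonneg_left hopp (sub_nonneg.2 h12)
        have m3 := mul_le_mul_of_nonneg_left htr3 (sub_nonneg.2 hw)
        simp
        linarith
      · refine good_of_perm ![0, 2, 1, 3] ![0, 2, 3, 1] ![0, 2, 1, 3]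
          (by decide) (by decide) (by decide) ?_
        have m1 := mul_le_mul_of_nonneg_left hd3 (sub_nonneg.2 h3)
        have m2 := mul_le_mul_of_nonneg_left hopp (sub_nonneg.2 h12)
        have m3 := mul_le_mul_of_nonneg_left hs (sub_nonneg.2 hw)
        simp
        linarith
    · rcases le_total (y 0 + y 3) (y 1 + y 2) with hw | hw
      · refine good_of_perm ![0, 1, 2, 3] ![0, 1, 3, 2] ![0, 2, 1, 3]
          (by decide) (by decide) (by decide) ?_
        have m1 := mul_le_mul_of_nonneg_left hd3 (sub_nonneg.2 h1)
        have m2 := mul_le_mul_of_nonneg_left hadj (sub_nonneg.2 h12)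
        have m3 := mul_le_mul_of_nonneg_left htr3 (sub_nonneg.2 hw)
        simp
        linarith
      · refine good_of_perm ![0, 1, 2, 3] ![0, 2, 3, 1] ![0, 2, 1, 3]
          (by decide) (by decide) (by decide) ?_
        have m1 := mul_le_mul_of_nonneg_left hd3 (sub_nonneg.2 h23)
        have m2 := mul_le_mul_of_nonneg_left hadj (sub_nonneg.2 h12)
        have m3 := mul_le_mul_of_nonneg_left hs (sub_nonneg.2 hw)
        simp
        linarith

lemma good_max {a b c y q : Fin 4 → ℝ} (h : Facets a b c q)
    (hm : ∀ i, y i ≤ y 0) : Good a b c y q := by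
  rcases le_total (y 3) (y 1) with h3 | h3
  · exact good_fund h (hm 1) (hm 2) h3
  · exact Good.of_refl (good_fund h.refl (hm _) (hm _) h3)

lemma good_step {a b c : Fin 4 → ℝ} (k l : Fin 4) (hkl : k + 1 = l)
    (ih : ∀ {y q : Fin 4 → ℝ}, Facets a b c q → (∀ i, y i ≤ y k) → Good a b c y q)
    {y q : Fin 4 → ℝ} (h : Facets a b c q) (hm : ∀ i, y i ≤ y l) : Good a b c y q :=
  Good.of_rot (ih h.rot (fun i => by rw [hkl]; exact hm (i + 1)))

lemma good_of_facets {a b c y q : Fin 4 → ℝ} (h : Facets a b c q) : Good a b c y q := by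
  obtain ⟨k, hk⟩ := Finite.exists_max y
  fin_cases k
  · exact good_max h hk
  · exact good_step 0 1 (by decide) good_max h hk
  · exact good_step 1 2 (by decide) (good_step 0 1 (by decide) good_max) h hk
  · exact good_step 2 3 (by decide)
      (good_step 1 2 (by decide) (good_step 0 1 (by decide) good_max)) h hk

lemma DoublyStochastic.convex {n : ℕ} {M N : Matrix (Fin n) (Fin n) ℝ}
    (hM : DoublyStochastic M) (hN : DoublyStochastic N) {s t : ℝ} (hs : 0 ≤ s) (ht : 0 ≤ t)
    (hst : s + t = 1) : DoublyStochastic (s • M + t • N) := by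
  refine ⟨fun i j => ?_, fun i => ?_, fun j => ?_⟩
  · have := hM.1 i j
    have := hN.1 i j
    simp only [Matrix.add_apply, Matrix.smul_apply, smul_eq_mul]
    positivity
  · simp only [Matrix.add_apply, Matrix.smul_apply, smul_eq_mul, Finset.sum_add_distrib,
      ← Finset.mul_sum, hM.2.1, hN.2.1]
    linarith
  · simp only [Matrix.add_apply, Matrix.smul_apply, smul_eq_mul, Finset.sum_add_distrib,
      ← Finset.mul_sum, hM.2.2, hN.2.2]
    linarith

/-- Permutation matrix. -/
noncomputable def pmat (s : Equiv.Perm (Fin 4)) : Matrix (Fin 4) (Fin 4) ℝ :=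
  Matrix.of fun i j => if j = s i then 1 else 0

lemma pmat_ds (s : Equiv.Perm (Fin 4)) : DoublyStochastic (pmat s) := by
  refine ⟨fun i j => ?_, fun i => ?_, fun j => ?_⟩
  · simp only [pmat, Matrix.of_apply]; split_ifs <;> norm_num
  · simp [pmat]
  · simp only [pmat, Matrix.of_apply]
    rw [← Equiv.sum_comp s.symm]
    simp

lemma pmat_mulVec (s : Equiv.Perm (Fin 4)) (r : Fin 4 → ℝ) :
    (pmat s).mulVec r = fun i => r (s i) := by
  ext i
  simp [pmat, Matrix.mulVec, dotProduct]

/-- The output vector. -/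
noncomputable def outv (r0 r1 r2 : Fin 4 → ℝ) (M0 M1 M2 : Matrix (Fin 4) (Fin 4) ℝ) :
    Fin 4 → ℝ :=
  M0.mulVec r0 + (1 + cyc 4).mulVec (M1.mulVec r1)
        + (1 / 2 : ℝ) • ((1 + cyc 4 ^ 2).mulVec (M2.mulVec r2))

lemma cyc_mulVec (x : Fin 4 → ℝ) : (1 + cyc 4).mulVec x =
    ![x 0 + x 3, x 1 + x 0, x 2 + x 1, x 3 + x 2] := by
  rw [Matrix.add_mulVec, Matrix.one_mulVec]
  ext i
  fin_cases i <;> simp [Matrix.mulVec, dotProduct, Fin.sum_univ_four, cyc]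

lemma cyc2_mulVec (x : Fin 4 → ℝ) : (1 + cyc 4 ^ 2).mulVec x =
    ![x 0 + x 2, x 1 + x 3, x 2 + x 0, x 3 + x 1] := by
  rw [Matrix.add_mulVec, Matrix.one_mulVec, pow_two]
  ext i
  fin_cases i <;> simp [Matrix.mulVec, dotProduct, Matrix.mul_apply, Fin.sum_univ_four, cyc]

lemma outv_val (r0 r1 r2 y : Fin 4 → ℝ) (s0 s1 s2 : Equiv.Perm (Fin 4)) :
    ∑ i, y i * outv r0 r1 r2 (pmat s0) (pmat s1) (pmat s2) i = vval r0 r1 r2 y s0 s1 s2 := by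
  have e1 : (1 : Fin 4) + 1 = 2 := by decide
  have e2 : (2 : Fin 4) + 1 = 3 := by decide
  have e3 : (3 : Fin 4) + 1 = 0 := by decide
  have g1 : (1 : Fin 4) + 2 = 3 := by decide
  have g2 : (2 : Fin 4) + 2 = 0 := by decide
  have g3 : (3 : Fin 4) + 2 = 1 := by decide
  simp only [outv, vval, pmat_mulVec, cyc_mulVec, cyc2_mulVec, Fin.sum_univ_four, zero_add,
    e1, e2, e3, g1, g2, g3, Pi.add_apply, Pi.smul_apply, smul_eq_mul]
  simp
  ring

/-- The set of reachable vectors. -/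
def reach (r0 r1 r2 : Fin 4 → ℝ) : Set (Fin 4 → ℝ) :=
  {x | ∃ M0 M1 M2 : Matrix (Fin 4) (Fin 4) ℝ,
      DoublyStochastic M0 ∧ DoublyStochastic M1 ∧ DoublyStochastic M2 ∧
      x = outv r0 r1 r2 M0 M1 M2}

lemma reach_convex (r0 r1 r2 : Fin 4 → ℝ) : Convex ℝ (reach r0 r1 r2) := by
  rintro x ⟨M0, M1, M2, h0, h1, h2, rfl⟩ z ⟨N0, N1, N2, k0, k1, k2, rfl⟩ s t hs ht hst
  refine ⟨s • M0 + t • N0, s • M1 + t • N1, s • M2 + t • N2, h0.convex k0 hs ht hst,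
    h1.convex k1 hs ht hst, h2.convex k2 hs ht hst, ?_⟩
  simp only [outv, Matrix.add_mulVec (_ • _) (_ • _), Matrix.smul_mulVec, Matrix.mulVec_add,
    Matrix.mulVec_smul]
  module

lemma mem_reach {r0 r1 r2 q : Fin 4 → ℝ} (h : ∀ y, Good r0 r1 r2 y q) :
    q ∈ reach r0 r1 r2 := by
  let V : Set (Fin 4 → ℝ) := Set.range
    (fun s : Equiv.Perm (Fin 4) × Equiv.Perm (Fin 4) × Equiv.Perm (Fin 4) =>
      outv r0 r1 r2 (pmat s.1) (pmat s.2.1) (pmat s.2.2))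
  have hV : convexHull ℝ V ⊆ reach r0 r1 r2 := by
    refine convexHull_min ?_ (reach_convex _ _ _)
    rintro _ ⟨s, rfl⟩
    exact ⟨_, _, _, pmat_ds _, pmat_ds _, pmat_ds _, rfl⟩
  apply hV
  by_contra hq
  obtain ⟨f, u, hf, hu⟩ := geometric_hahn_banach_closed_point (convex_convexHull ℝ V)
    (Set.Finite.isClosed_convexHull (𝕜 := ℝ) (Set.finite_range _)) hq
  have key : ∀ x : Fin 4 → ℝ, f x = ∑ i, f (Pi.single i 1) * x i := by
    intro x
    conv_lhs => rw [pi_eq_sum_univ' x]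
    simp [map_sum, mul_comm]
  obtain ⟨s0, s1, s2, hs⟩ := h (fun i => f (Pi.single i 1))
  have h1 := hf _ (subset_convexHull ℝ V ⟨(s0, s1, s2), rfl⟩)
  rw [key] at h1 hu
  have := outv_val r0 r1 r2 (fun i => f (Pi.single i 1)) s0 s1 s2
  simp only at this hs h1
  linarith

lemma Good.perm {a b c y q : Fin 4 → ℝ} (t0 t1 t2 : Equiv.Perm (Fin 4))
    (h : Good (fun i => a (t0 i)) (fun i => b (t1 i)) (fun i => c (t2 i)) y q) :
    Good a b c y q := by
  obtain ⟨s0, s1, s2, h⟩ := h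
  exact ⟨s0.trans t0, s1.trans t1, s2.trans t2, h⟩

/-- The facet inequalities hold, in scalar form. -/
lemma scalar_facets {p0 p1 p2 p3 q0 q1 q2 q3 : ℝ}
    (h3 : 0 < p3) (h23 : p3 ≤ p2) (h12 : p2 ≤ p1) (h01 : p1 ≤ p0)
    (hs : p0 + p1 + p2 + p3 = 1) (hq : q0 + q1 + q2 + q3 = 1)
    (k23 : q3 ≤ q2) (k12 : q2 ≤ q1) (k01 : q1 ≤ q0) (k3 : 0 < q3)
    (c01 : q0 * p1 ≤ q1 * p0) (c02 : q0 * p2 ≤ q2 * p0) (c03 : q0 * p3 ≤ q3 * p0)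
    (c12 : q1 * p2 ≤ q2 * p1) (c13 : q1 * p3 ≤ q3 * p1) (c23 : q2 * p3 ≤ q3 * p2) :
    q0 ≤ p0 ∧ p3 ≤ q3 ∧ q0 + q1 ≤ p0 + p1 ∧ q0 + q2 ≤ p0 + p2 + p1 ^ 2 - p2 ^ 2 ∧
    q0 - q2 ≤ p0 - p2 ∧ q1 - q3 ≤ p1 - p3 + p0 ^ 2 - p1 ^ 2 := by
  have H0 : q0 ≤ p0 := by
    have e : q0 * (p0 + p1 + p2 + p3) ≤ p0 * (q0 + q1 + q2 + q3) := by linarith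
    rw [hs, hq] at e; linarith
  have H3 : p3 ≤ q3 := by
    have e : p3 * (q0 + q1 + q2 + q3) ≤ q3 * (p0 + p1 + p2 + p3) := by linarith
    rw [hs, hq] at e; linarith
  have H01 : q0 + q1 ≤ p0 + p1 := by
    have e : (q0 + q1) * (p0 + p1 + p2 + p3) ≤ (p0 + p1) * (q0 + q1 + q2 + q3) := by linarith
    rw [hs, hq] at e; linarith
  refine ⟨H0, H3, H01, ?_, ?_, ?_⟩
  · rcases le_total (p1 * p2) (p0 * p3) with hc | hc
    · have a1 : q0 * (p0 + p1) ≤ (q0 + q1) * p0 := by linarith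
      have a2 : q2 * (p2 + p3) ≤ (q2 + q3) * p2 := by linarith
      have hpos : 0 < (p0 + p1) * (p2 + p3) := by
        apply mul_pos <;> linarith
      have : (q0 + q2 - (p0 + p2)) * ((p0 + p1) * (p2 + p3)) ≤ 0 := by
        have b1 := mul_le_mul_of_nonneg_right a1 (show 0 ≤ p2 + p3 by linarith)
        have b2 := mul_le_mul_of_nonneg_right a2 (show 0 ≤ p0 + p1 by linarith)
        have b3 := mul_nonneg (sub_nonneg.2 H01) (sub_nonneg.2 hc)
        have e3 : q3 = 1 - q0 - q1 - q2 := by linarith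
        have f3 : p3 = 1 - p0 - p1 - p2 := by linarith
        subst e3 f3
        nlinarith
      have h4 : q0 + q2 - (p0 + p2) ≤ 0 := by
        by_contra hcon
        push Not at hcon
        have := mul_pos hcon hpos
        linarith
      nlinarith
    · set D := p0 * p2 + 2 * (p1 * p2) + p1 * p3 with hD
      have q2p : 0 < p2 := by linarith
      have q1p : 0 < p1 := by linarith
      have q0p : 0 < p0 := by linarith
      have hDpos : 0 < D := by positivity
      have m1 := mul_nonneg (show 0 ≤ p2 + p3 by linarith) (sub_nonneg.2 c01)
      have m2 := mul_nonneg (show 0 ≤ p0 + p1 by linarith) (sub_nonneg.2 c23)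
      have m3 := mul_nonneg (sub_nonneg.2 hc) (sub_nonneg.2 k12)
      have A : D * (q0 + q2) ≤ p2 * (p0 + p1) * (q0 + q1 + q2 + q3) := by
        rw [hD]; linarith
      rw [hq, mul_one] at A
      have n1 : 0 ≤ (p1 - p2) * ((p1 + p2) * D - (p1 * p2 - p0 * p3) * (p0 + p1 + p2 + p3)) := by
        apply mul_nonneg (by linarith)
        rw [hD]
        have : 0 ≤ (p1 - p2) * (p1 * p3) := mul_nonneg (by linarith) (by positivity)
        have l1 : 0 ≤ p0 * p3 * (p0 + p1 + p2 + p3) := by positivity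
        have l2 : 0 ≤ p1 * p1 * p2 := by positivity
        have l3 : 0 ≤ p1 * p2 * p2 := by positivity
        have l4 : 0 ≤ p0 * p2 * p2 := by positivity
        nlinarith
      have B : p2 * (p0 + p1) ≤ D * (p0 + p2 + p1 ^ 2 - p2 ^ 2) := by
        have id1 : D * (p0 + p2) - p2 * (p0 + p1) * (p0 + p1 + p2 + p3)
            = (p1 - p2) * (p0 * p3 - p1 * p2) := by
          have f3 : p3 = 1 - p0 - p1 - p2 := by linarith
          rw [hD]
          subst f3
          ring
        rw [hs] at n1 id1
        nlinarith
      exact le_of_mul_le_mul_left (A.trans B) hDpos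
  · have q2p : 0 < p2 := by linarith
    have z : p3 * (q0 - q2) ≤ q3 * (p0 - p2) := by
      have z1 := mul_le_mul_of_nonneg_left c02 h3.le
      have z2 := mul_le_mul_of_nonneg_right c23 (show 0 ≤ p0 - p2 by linarith)
      refine le_of_mul_le_mul_left (a := p2) ?_ q2p
      linarith
    have e : (q0 - q2) * (p0 + p1 + p2 + p3) ≤ (p0 - p2) * (q0 + q1 + q2 + q3) := by linarith
    rw [hs, hq] at e; linarith
  · set D := 2 * p1 + p2 + p3 with hD
    have hDpos : 0 < D := by rw [hD]; linarith
    have A : D * (q1 - q3) ≤ (p1 - p3) * (q0 + q1 + q2 + q3) := by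
      have := mul_nonneg (show 0 ≤ p1 - p3 by linarith) (sub_nonneg.2 k01)
      rw [hD]; linarith
    rw [hq, mul_one] at A
    have B : p1 - p3 ≤ D * (p1 - p3 + p0 ^ 2 - p1 ^ 2) := by
      have n1 : 0 ≤ (p0 - p1) * ((p0 + p1) * D - (p1 - p3) * (p0 + p1 + p2 + p3)) := by
        apply mul_nonneg (by linarith)
        rw [hD]
        have q2p : 0 < p2 := by linarith
        have q1p : 0 < p1 := by linarith
        have q0p : 0 < p0 := by linarith
        have : 0 ≤ p0 * p1 := by positivity
        have : 0 ≤ p0 * p2 := by positivity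
        have : 0 ≤ p0 * p3 := by positivity
        have : 0 ≤ p1 * p1 := by positivity
        have : 0 ≤ p1 * p2 := by positivity
        have : 0 ≤ p1 * p3 := by positivity
        have : 0 ≤ p3 * p2 := by positivity
        have : 0 ≤ p3 * p3 := by positivity
        nlinarith
      have hD2 : D = 1 + p1 - p0 := by rw [hD]; linarith
      rw [hs] at n1
      rw [hD2] at n1 ⊢
      nlinarith
    exact le_of_mul_le_mul_left (A.trans B) hDpos

lemma facets_main {p q : Fin 4 → ℝ}
    (h3 : 0 < p 3) (h23 : p 3 ≤ p 2) (h12 : p 2 ≤ p 1) (h01 : p 1 ≤ p 0)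
    (hs : p 0 + p 1 + p 2 + p 3 = 1) (hq : q 0 + q 1 + q 2 + q 3 = 1)
    (k23 : q 3 ≤ q 2) (k12 : q 2 ≤ q 1) (k01 : q 1 ≤ q 0)
    (H0 : q 0 ≤ p 0) (H3 : p 3 ≤ q 3) (H01 : q 0 + q 1 ≤ p 0 + p 1)
    (H02 : q 0 + q 2 ≤ p 0 + p 2 + p 1 ^ 2 - p 2 ^ 2)
    (D02 : q 0 - q 2 ≤ p 0 - p 2) (D13 : q 1 - q 3 ≤ p 1 - p 3 + p 0 ^ 2 - p 1 ^ 2)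
    (m n : ℝ) (hmn : m + n = p 0 * p 3 + p 1 * p 2) (hm1 : p 0 * p 3 ≤ m) (hm2 : p 1 * p 2 ≤ m)
    : Facets ![p 0 * p 0, p 1 * p 1, p 2 * p 2, p 3 * p 3]
        ![p 0 * p 1, m, n, p 2 * p 3]
        ![p 0 * p 2, p 0 * p 2, p 1 * p 3, p 1 * p 3] q := by
  have w0 : p 0 * (p 0 + p 1 + p 2 + p 3) = p 0 := by rw [hs, mul_one]
  have w1 : p 1 * (p 0 + p 1 + p 2 + p 3) = p 1 := by rw [hs, mul_one]
  have w2 : p 2 * (p 0 + p 1 + p 2 + p 3) = p 2 := by rw [hs, mul_one]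
  have w3 : p 3 * (p 0 + p 1 + p 2 + p 3) = p 3 := by rw [hs, mul_one]
  have s23 : 0 ≤ (p 2 - p 3) * (p 2 + p 3) := mul_nonneg (by linarith) (by linarith)
  constructor
  · simp [Fin.sum_univ_four]
    linarith
  · have : ∀ i, q i ≤ q 0 := by
      intro i; fin_cases i <;> simp <;> linarith
    intro i
    refine (this i).trans ?_
    simp
    linarith
  · have : ∀ i, q 3 ≤ q i := by
      intro i; fin_cases i <;> simp <;> linarith
    intro i
    refine le_trans ?_ (this i)
    simp
    linarith
  · have : ∀ i j : Fin 4, (j = i + 1 ∨ i = j + 1) → q i + q j ≤ q 0 + q 1 := by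
      intro i j; fin_cases i <;> fin_cases j <;> simp <;> linarith
    intro i j hij
    refine (this i j hij).trans ?_
    simp
    linarith
  · have : ∀ i j : Fin 4, j = i + 2 → q i + q j ≤ q 0 + q 2 := by
      intro i j; fin_cases i <;> fin_cases j <;> simp <;> linarith
    intro i j hij
    refine (this i j hij).trans ?_
    simp
    linarith
  · have : ∀ i j : Fin 4, (j = i + 1 ∨ i = j + 1) → q i - q j ≤ q 0 - q 3 := by
      intro i j; fin_cases i <;> fin_cases j <;> simp <;> linarith
    intro i j hij
    refine (this i j hij).trans ?_
    simp
    linarith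
  · have : ∀ i j : Fin 4, j = i + 2 → q i - q j ≤ p 0 * p 0 - p 3 * p 3 + p 0 * p 1 + m - n
        - p 2 * p 3 := by
      intro i j; fin_cases i <;> fin_cases j <;> simp <;> linarith
    intro i j hij
    refine (this i j hij).trans ?_
    simp

lemma gibbs_sum (E : Fin 4 → ℝ) (β : ℝ) : ∑ i, gibbs E β i = 1 := by
  simp only [gibbs]
  rw [← Finset.sum_div]
  exact div_self (ne_of_gt (Finset.sum_pos (fun i _ => Real.exp_pos _) ⟨0, Finset.mem_univ _⟩))

lemma gibbs_pos (E : Fin 4 → ℝ) (β : ℝ) (i : Fin 4) : 0 < gibbs E β i :=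
  div_pos (Real.exp_pos _)
    (Finset.sum_pos (fun i _ => Real.exp_pos _) ⟨0, Finset.mem_univ _⟩)

lemma gibbs_anti (E : Fin 4 → ℝ) (hE : Monotone E) (β : ℝ) (hβ : 0 ≤ β) {i j : Fin 4}
    (hij : i ≤ j) : gibbs E β j ≤ gibbs E β i := by
  have : β * E i ≤ β * E j := mul_le_mul_of_nonneg_left (hE hij) hβ
  refine div_le_div_of_nonneg_right (Real.exp_le_exp.2 (by linarith)) ?_
  exact (Finset.sum_pos (fun i _ => Real.exp_pos _) ⟨0, Finset.mem_univ _⟩).le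

lemma gibbs_cross (E : Fin 4 → ℝ) (hE : Monotone E) (β' β : ℝ) (h : β' ≤ β) {i j : Fin 4}
    (hij : i ≤ j) : gibbs E β' i * gibbs E β j ≤ gibbs E β' j * gibbs E β i := by
  simp only [gibbs, div_mul_div_comm, ← Real.exp_add]
  refine div_le_div_of_nonneg_right (Real.exp_le_exp.2 ?_) ?_
  · have := mul_nonneg (sub_nonneg.2 h) (sub_nonneg.2 (hE hij))
    linarith
  · apply mul_nonneg <;> exact Finset.sum_nonneg (fun i _ => (Real.exp_pos _).le)

theorem symmetric_thermalization_dim4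
    (E : Fin 4 → ℝ) (hE : Monotone E)
    (β' β : ℝ) (hβ' : 0 ≤ β') (hββ : β' ≤ β)
    (p q : Fin 4 → ℝ) (hp : p = gibbs E β) (hq : q = gibbs E β')
    (r0 r1 r2 : Fin 4 → ℝ)
    (hr0 : r0 = fun j => p j * p j)
    (hr1 : r1 = fun j => p j * p (j + 1))
    (hr2 : r2 = fun j => p j * p (j + 2)) :
    ∃ M0 M1 M2 : Matrix (Fin 4) (Fin 4) ℝ,
      DoublyStochastic M0 ∧ DoublyStochastic M1 ∧ DoublyStochastic M2 ∧
      q = M0.mulVec r0 + (1 + cyc 4).mulVec (M1.mulVec r1)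
        + (1 / 2 : ℝ) • ((1 + cyc 4 ^ 2).mulVec (M2.mulVec r2)) := by
  have hβ : 0 ≤ β := hβ'.trans hββ
  have p3 : 0 < p 3 := hp ▸ gibbs_pos E β 3
  have q3 : 0 < q 3 := hq ▸ gibbs_pos E β' 3
  have ap : ∀ i j : Fin 4, i ≤ j → p j ≤ p i := fun i j h => hp ▸ gibbs_anti E hE β hβ h
  have aq : ∀ i j : Fin 4, i ≤ j → q j ≤ q i := fun i j h => hq ▸ gibbs_anti E hE β' hβ' h
  have cr : ∀ i j : Fin 4, i ≤ j → q i * p j ≤ q j * p i :=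
    fun i j h => hp ▸ hq ▸ gibbs_cross E hE β' β hββ h
  have sp : p 0 + p 1 + p 2 + p 3 = 1 := by
    rw [← Fin.sum_univ_four, hp]; exact gibbs_sum E β
  have sq : q 0 + q 1 + q 2 + q 3 = 1 := by
    rw [← Fin.sum_univ_four, hq]; exact gibbs_sum E β'
  have p23 := ap 2 3 (by decide)
  have p12 := ap 1 2 (by decide)
  have p01 := ap 0 1 (by decide)
  have q23 := aq 2 3 (by decide)
  have q12 := aq 1 2 (by decide)
  have q01 := aq 0 1 (by decide)
  obtain ⟨H0, H3, H01, H02, D02, D13⟩ := scalar_facets p3 p23 p12 p01 sp sq q23 q12 q01 q3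
    (cr 0 1 (by decide)) (cr 0 2 (by decide)) (cr 0 3 (by decide))
    (cr 1 2 (by decide)) (cr 1 3 (by decide)) (cr 2 3 (by decide))
  have F := fun m n => facets_main p3 p23 p12 p01 sp sq q23 q12 q01 H0 H3 H01 H02 D02 D13 m n
  have e1 : (1 : Fin 4) + 1 = 2 := by decide
  have e2 : (2 : Fin 4) + 1 = 3 := by decide
  have e3 : (3 : Fin 4) + 1 = 0 := by decide
  have g1 : (1 : Fin 4) + 2 = 3 := by decide
  have g2 : (2 : Fin 4) + 2 = 0 := by decide
  have g3 : (3 : Fin 4) + 2 = 1 := by decide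
  obtain ⟨t2, t20, t21, t22, t23⟩ := exists_perm ![0, 2, 1, 3] (by decide)
  have v0 : (fun i => r0 ((Equiv.refl (Fin 4)) i))
      = ![p 0 * p 0, p 1 * p 1, p 2 * p 2, p 3 * p 3] := by
    ext i; fin_cases i <;> simp [hr0]
  have v2 : (fun i => r2 (t2 i)) = ![p 0 * p 2, p 0 * p 2, p 1 * p 3, p 1 * p 3] := by
    ext i; fin_cases i <;> simp [hr2, t20, t21, t22, t23, g1, g2, g3, mul_comm]
  refine mem_reach (fun y => ?_)
  rcases le_total (p 0 * p 3) (p 1 * p 2) with hc | hc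
  · obtain ⟨t1, t10, t11, t12, t13⟩ := exists_perm ![0, 1, 3, 2] (by decide)
    refine Good.perm (Equiv.refl _) t1 t2 ?_
    have v1 : (fun i => r1 (t1 i)) = ![p 0 * p 1, p 1 * p 2, p 0 * p 3, p 2 * p 3] := by
      ext i; fin_cases i <;> simp [hr1, t10, t11, t12, t13, e1, e2, e3, mul_comm]
    rw [v0, v1, v2]
    exact good_of_facets (F _ _ (by ring) hc le_rfl)
  · obtain ⟨t1, t10, t11, t12, t13⟩ := exists_perm ![0, 3, 1, 2] (by decide)
    refine Good.perm (Equiv.refl _) t1 t2 ?_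
    have v1 : (fun i => r1 (t1 i)) = ![p 0 * p 1, p 0 * p 3, p 1 * p 2, p 2 * p 3] := by
      ext i; fin_cases i <;> simp [hr1, t10, t11, t12, t13, e1, e2, e3, mul_comm]
    rw [v0, v1, v2]
    exact good_of_facets (F _ _ (by ring) le_rfl hc)
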